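/- Let n ≥ 1 and α > -n. There exists a constant C > 0 such that for all x, y ∈ ℝⁿ and all s, t > 0, |Ω_α(x,y;s,t)| ≤ C t/(s+t+|x-y|)^{n+1}. -/

import Mathlib

open Real MeasureTheory Set

/-- The Mehler (Hermite heat) kernel on ℝⁿ. -/
noncomputable def W (n : ℕ) (s : ℝ) (x y : EuclideanSpace ℝ (Fin n)) : ℝ :=
  (Real.exp (-2 * s) / (Real.pi * (1 - Real.exp (-4 * s)))) ^ ((n : ℝ) / 2) *
    Real.exp (-(1 / 4) * ((1 + Real.exp (-2 * s)) / (1 - Real.exp (-2 * s)) * ‖x - y‖ ^ 2 +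
      (1 - Real.exp (-2 * s)) / (1 + Real.exp (-2 * s)) * ‖x + y‖ ^ 2))

/-- Ω_α(x,y;s,t) = t ∂_t P_{t+s}^α(x,y). -/
noncomputable def Om (n : ℕ) (α : ℝ) (x y : EuclideanSpace ℝ (Fin n)) (s t : ℝ) : ℝ :=
  t / Real.sqrt (4 * Real.pi) *
    ∫ u in Set.Ioi (0 : ℝ), u ^ (-(3 : ℝ) / 2) * (1 - (t + s) ^ 2 / (2 * u)) *
      Real.exp (-(t + s) ^ 2 / (4 * u)) * Real.exp (-α * u) * W n u x y

/-- Gaussian upper bound for the shifted Hermite heat kernel. -/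
lemma exists_exp_mul_W_le (n : ℕ) (hn : 1 ≤ n) (α : ℝ) (hα : -(n : ℝ) < α) :
    ∃ C > (0 : ℝ), ∀ (x y : EuclideanSpace ℝ (Fin n)) (u : ℝ), 0 < u →
      Real.exp (-α * u) * W n u x y ≤
        C * (u ^ (-((n : ℝ) / 2)) * Real.exp (-(‖x - y‖ ^ 2 / (8 * u)))) := by
  have hn' : (0 : ℝ) < n := by exact_mod_cast hn
  set m : ℝ := (n : ℝ) / 2 with hm
  have hm0 : 0 < m := by positivity
  set c : ℝ := (α + n) / m with hc
  have hδ : 0 < α + n := by linarith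
  have hc0 : 0 < c := by positivity
  have hcm : c * m = α + n := by rw [hc]; field_simp
  set B : ℝ := 1 + 4 / c with hB
  have hB0 : 0 < B := by positivity
  refine ⟨B ^ m, by positivity, fun x y u hu => ?_⟩
  have hq1 : Real.exp (-2 * u) < 1 := by rw [Real.exp_lt_one_iff]; linarith
  have hq0 : 0 < Real.exp (-2 * u) := Real.exp_pos _
  have hq2 : 1 - Real.exp (-2 * u) ≤ 2 * u := by
    have := Real.add_one_le_exp (-2 * u)
    linarith
  have hp1 : Real.exp (-4 * u) < 1 := by rw [Real.exp_lt_one_iff]; linarith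
  have hp2 : 4 * u / (1 + 4 * u) ≤ 1 - Real.exp (-4 * u) := by
    have h1 := Real.add_one_le_exp (4 * u)
    have h2 : Real.exp (-4 * u) ≤ 1 / (1 + 4 * u) := by
      rw [show -4 * u = -(4 * u) by ring, Real.exp_neg, ← one_div]
      exact one_div_le_one_div_of_le (by linarith) (by linarith)
    have h3 : 4 * u / (1 + 4 * u) = 1 - 1 / (1 + 4 * u) := by field_simp; ring
    linarith
  have hbase : Real.exp (-2 * u) / (π * (1 - Real.exp (-4 * u))) ≤
      Real.exp (-2 * u) * (B * Real.exp (c * u) * u⁻¹) := by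
    rw [div_eq_mul_inv]
    gcongr
    have h1 : 4 * u / (1 + 4 * u) ≤ π * (1 - Real.exp (-4 * u)) := by
      have := Real.pi_gt_three
      nlinarith
    have h2 : 1 + 4 * u ≤ B * Real.exp (c * u) := by
      have h3 := Real.add_one_le_exp (c * u)
      have h4 : B * (c * u + 1) = 1 + 4 * u + c * u + 4 / c := by
        rw [hB]; field_simp; ring
      have h5 : B * (c * u + 1) ≤ B * Real.exp (c * u) := by gcongr
      have : 0 < 4 / c := by positivity
      nlinarith [mul_pos hc0 hu]
    calc (π * (1 - Real.exp (-4 * u)))⁻¹ ≤ (4 * u / (1 + 4 * u))⁻¹ :=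
          inv_anti₀ (by positivity) h1
      _ = (1 + 4 * u) * u⁻¹ / 4 := by field_simp
      _ ≤ (1 + 4 * u) * u⁻¹ := by
          have : 0 < (1 + 4 * u) * u⁻¹ := by positivity
          linarith
      _ ≤ B * Real.exp (c * u) * u⁻¹ := by gcongr
  have hpow : Real.exp (-α * u) *
      (Real.exp (-2 * u) / (π * (1 - Real.exp (-4 * u)))) ^ m ≤ B ^ m * u ^ (-m) := by
    have h0 : 0 < π * (1 - Real.exp (-4 * u)) := mul_pos Real.pi_pos (by linarith)
    calc _ ≤ Real.exp (-α * u) * (Real.exp (-2 * u) * (B * Real.exp (c * u) * u⁻¹)) ^ m := by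
          gcongr
      _ = (Real.exp (-α * u) * Real.exp (-2 * u * m) * Real.exp (c * u * m)) *
            (B ^ m * u ^ (-m)) := by
          rw [Real.mul_rpow (by positivity) (by positivity),
            Real.mul_rpow (by positivity) (by positivity),
            Real.mul_rpow (by positivity) (by positivity), ← Real.exp_mul, ← Real.exp_mul,
            Real.inv_rpow hu.le, ← Real.rpow_neg hu.le]
          ring
      _ = B ^ m * u ^ (-m) := by
          rw [← Real.exp_add, ← Real.exp_add]
          have : -α * u + -2 * u * m + c * u * m = 0 := by
            have : c * u * m = (α + n) * u := by rw [← hcm]; ring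
            rw [this, hm]; ring
          rw [this, Real.exp_zero, one_mul]
  have hexp : Real.exp (-(1 / 4) * ((1 + Real.exp (-2 * u)) / (1 - Real.exp (-2 * u)) *
      ‖x - y‖ ^ 2 + (1 - Real.exp (-2 * u)) / (1 + Real.exp (-2 * u)) * ‖x + y‖ ^ 2)) ≤
      Real.exp (-(‖x - y‖ ^ 2 / (8 * u))) := by
    rw [Real.exp_le_exp]
    have h1 : 1 / (2 * u) ≤ (1 + Real.exp (-2 * u)) / (1 - Real.exp (-2 * u)) :=
      div_le_div₀ (by linarith) (by linarith) (by linarith) hq2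
    have h2 : 0 ≤ (1 - Real.exp (-2 * u)) / (1 + Real.exp (-2 * u)) * ‖x + y‖ ^ 2 :=
      mul_nonneg (div_nonneg (by linarith) (by linarith)) (by positivity)
    have h3 := mul_le_mul_of_nonneg_right h1 (sq_nonneg ‖x - y‖)
    have h4 : ‖x - y‖ ^ 2 / (8 * u) = 1 / 4 * (1 / (2 * u) * ‖x - y‖ ^ 2) := by
      ring
    rw [h4]
    linarith
  calc _ = (Real.exp (-α * u) *
        (Real.exp (-2 * u) / (π * (1 - Real.exp (-4 * u)))) ^ m) * _ := by
          rw [W, ← mul_assoc]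
    _ ≤ (B ^ m * u ^ (-m)) * Real.exp (-(‖x - y‖ ^ 2 / (8 * u))) := by gcongr
    _ = _ := by ring

/-- The substitution `v = u⁻¹` in the Gamma integral: integrability. -/
lemma integrableOn_rpow_mul_exp_neg_div {a A : ℝ} (ha : 0 < a) (hA : 0 < A) :
    IntegrableOn (fun u : ℝ => u ^ (-a - 1) * Real.exp (-(A / u))) (Ioi 0) := by
  have h := (integrableOn_Ioi_comp_rpow_iff (fun v : ℝ => v ^ (a - 1) * Real.exp (-A * v))
    (p := -1) (by norm_num)).2
    (by
      simpa using integrableOn_rpow_mul_exp_neg_mul_rpow (s := a - 1) (p := 1)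
        (by linarith) one_pos hA)
  refine h.congr_fun (fun u hu => ?_) measurableSet_Ioi
  have hu : 0 < u := hu
  simp only [smul_eq_mul]
  rw [← Real.rpow_mul hu.le, ← mul_assoc, abs_neg, abs_one, one_mul, ← Real.rpow_add hu,
    Real.rpow_neg_one]
  congr 2 <;> ring

/-- The substitution `v = u⁻¹` in the Gamma integral. -/
lemma integral_rpow_mul_exp_neg_div {a A : ℝ} (ha : 0 < a) (hA : 0 < A) :
    ∫ u in Ioi (0 : ℝ), u ^ (-a - 1) * Real.exp (-(A / u)) = (1 / A) ^ a * Real.Gamma a := by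
  rw [← Real.integral_rpow_mul_exp_neg_mul_Ioi ha hA,
    ← integral_comp_rpow_Ioi (fun v : ℝ => v ^ (a - 1) * Real.exp (-(A * v)))
      (p := -1) (by norm_num)]
  refine setIntegral_congr_fun measurableSet_Ioi (fun u hu => ?_)
  have hu : 0 < u := hu
  simp only [smul_eq_mul]
  rw [← Real.rpow_mul hu.le, ← mul_assoc, abs_neg, abs_one, one_mul, ← Real.rpow_add hu,
    Real.rpow_neg_one]
  congr 2
  ring

/-- The polynomial factor in the derivative of the Poisson subordinator is absorbed by half of
the exponential. -/
lemma abs_one_sub_mul_exp_le {T u : ℝ} (hu : 0 < u) :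
    |1 - T ^ 2 / (2 * u)| * Real.exp (-T ^ 2 / (4 * u)) ≤
      4 * Real.exp (-(T ^ 2 / (8 * u))) := by
  have hz : 0 ≤ T ^ 2 / (8 * u) := by positivity
  set z := T ^ 2 / (8 * u) with hzdef
  have h1 : T ^ 2 / (2 * u) = 4 * z := by rw [hzdef]; ring
  have h2 : -T ^ 2 / (4 * u) = -z + -z := by rw [hzdef]; ring
  have h3 : |1 - 4 * z| ≤ 4 * Real.exp z := by
    have := Real.add_one_le_exp z
    rw [abs_le]
    constructor <;> linarith
  rw [h1, h2, Real.exp_add, ← mul_assoc]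
  gcongr
  calc |1 - 4 * z| * Real.exp (-z) ≤ 4 * Real.exp z * Real.exp (-z) := by gcongr
    _ = 4 := by rw [mul_assoc, ← Real.exp_add]; simp

lemma W_nonneg (n : ℕ) {u : ℝ} (hu : 0 < u) (x y : EuclideanSpace ℝ (Fin n)) :
    0 ≤ W n u x y := by
  have hp1 : Real.exp (-4 * u) < 1 := by rw [Real.exp_lt_one_iff]; linarith
  have h0 : 0 < π * (1 - Real.exp (-4 * u)) := mul_pos Real.pi_pos (by linarith)
  unfold W
  positivity

theorem Om_bound (n : ℕ) (hn : 1 ≤ n) (α : ℝ) (hα : -(n : ℝ) < α) :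
    ∃ C > (0 : ℝ), ∀ (x y : EuclideanSpace ℝ (Fin n)) (s t : ℝ), 0 < s → 0 < t →
      |Om n α x y s t| ≤ C * t / (s + t + ‖x - y‖) ^ (n + 1) := by
  obtain ⟨K, hK, hW⟩ := exists_exp_mul_W_le n hn α hα
  set a : ℝ := ((n : ℝ) + 1) / 2 with ha
  have ha0 : 0 < a := by positivity
  have hΓ := Real.Gamma_pos_of_pos ha0
  refine ⟨1 / √(4 * π) * (4 * K * (4 ^ (n + 1) * Real.Gamma a)), by positivity,
    fun x y s t hs ht => ?_⟩
  set r := ‖x - y‖ with hr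
  have hr0 : 0 ≤ r := norm_nonneg _
  set A : ℝ := ((t + s) ^ 2 + r ^ 2) / 8 with hA
  have hA0 : 0 < A := by positivity
  set R : ℝ := s + t + r with hR
  have hR0 : 0 < R := by positivity
  have hAR : (R / 4) ^ 2 ≤ A := by
    rw [hA, hR]
    nlinarith [sq_nonneg (t + s - r)]
  have hApow : (1 / A) ^ a ≤ 4 ^ (n + 1) / R ^ (n + 1) := by
    calc (1 / A) ^ a ≤ ((4 / R) ^ (2 : ℝ)) ^ a := by
          apply Real.rpow_le_rpow (by positivity) _ ha0.le
          rw [Real.rpow_two, show (4 / R) ^ 2 = 1 / (R / 4) ^ 2 by field_simp]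
          exact one_div_le_one_div_of_le (by positivity) hAR
      _ = 4 ^ (n + 1) / R ^ (n + 1) := by
          rw [← Real.rpow_mul (by positivity), ha,
            show (2 : ℝ) * (((n : ℝ) + 1) / 2) = ((n + 1 : ℕ) : ℝ) by push_cast; ring,
            Real.rpow_natCast, div_pow]
  have hint := norm_integral_le_of_norm_le (μ := volume.restrict (Ioi (0 : ℝ)))
    (f := fun u => u ^ (-(3 : ℝ) / 2) * (1 - (t + s) ^ 2 / (2 * u)) *
      Real.exp (-(t + s) ^ 2 / (4 * u)) * Real.exp (-α * u) * W n u x y)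
    ((integrableOn_rpow_mul_exp_neg_div ha0 hA0).const_mul (4 * K))
    ((ae_restrict_iff' measurableSet_Ioi).2 (Filter.Eventually.of_forall fun u hu => by
      have hu : 0 < u := hu
      have h1 := abs_one_sub_mul_exp_le (T := t + s) hu
      have h2 := hW x y u hu
      have hW0 := W_nonneg n hu x y
      rw [Real.norm_eq_abs, abs_mul, abs_mul, abs_mul, abs_mul, Real.abs_exp, Real.abs_exp,
        abs_of_nonneg hW0, abs_of_pos (Real.rpow_pos_of_pos hu _)]
      calc _ = u ^ (-(3 : ℝ) / 2) * (|1 - (t + s) ^ 2 / (2 * u)| *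
            Real.exp (-(t + s) ^ 2 / (4 * u))) * (Real.exp (-α * u) * W n u x y) := by ring
        _ ≤ u ^ (-(3 : ℝ) / 2) * (4 * Real.exp (-((t + s) ^ 2 / (8 * u)))) *
            (K * (u ^ (-((n : ℝ) / 2)) * Real.exp (-(r ^ 2 / (8 * u))))) := by gcongr
        _ = 4 * K * ((u ^ (-(3 : ℝ) / 2) * u ^ (-((n : ℝ) / 2))) *
            (Real.exp (-((t + s) ^ 2 / (8 * u))) * Real.exp (-(r ^ 2 / (8 * u))))) := by ring
        _ = 4 * K * (u ^ (-a - 1) * Real.exp (-(A / u))) := by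
            rw [← Real.rpow_add hu, ← Real.exp_add]
            congr 3
            · rw [ha]; ring
            · rw [hA]; field_simp; ring))
  rw [integral_const_mul, integral_rpow_mul_exp_neg_div ha0 hA0, Real.norm_eq_abs] at hint
  rw [Om, abs_mul, abs_of_pos (by positivity : 0 < t / √(4 * π))]
  calc _ ≤ t / √(4 * π) * (4 * K * (4 ^ (n + 1) / R ^ (n + 1) * Real.Gamma a)) := by
        refine mul_le_mul_of_nonneg_left (hint.trans ?_) (by positivity)
        gcongr
    _ = _ := by ring
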